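/- With G, G_b, S, T as in the context: there is a reconfiguration of valid configurations from D to D' in G if and only if there exists a sequence of TS moves transforming S into T through independent sets of G_b such that no independent set in the sequence contains both e_u and e_v for any edge e = (u,v) of G. -/

import Mathlib

open SimpleGraph

/-- A single token-sliding (TS) move from `S` to `T`. -/
def TSMove {α : Type*} (G : SimpleGraph α) (S T : Set α) : Prop :=
  S.ncard = T.ncard ∧ ∃ u v : α, G.Adj u v ∧ T \ S = {u} ∧ S \ T = {v}

/-- `S` is an independent set of `G`. -/
def IsIndep {α : Type*} (G : SimpleGraph α) (S : Set α) : Prop :=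
  S.Pairwise fun u v => ¬ G.Adj u v

/-- The weighted in-degree of `v` under the orientation `D` (given by its head
function) of the NCL instance with red graph `R` (weight 1) and blue graph `B`
(weight 2). -/
noncomputable def wInDeg {V : Type*} (R B : SimpleGraph V) (D : Sym2 V → V) (v : V) : ℕ :=
  {e ∈ R.edgeSet | D e = v}.ncard + 2 * {e ∈ B.edgeSet | D e = v}.ncard

/-- `D` is a valid configuration of the NCL instance `(R, B)`: every edge is
oriented towards one of its endpoints and every vertex has weighted in-degree
at least 2. -/
def ValidConf {V : Type*} (R B : SimpleGraph V) (D : Sym2 V → V) : Prop :=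
  (∀ e ∈ R.edgeSet ∪ B.edgeSet, D e ∈ e) ∧ ∀ v : V, 2 ≤ wInDeg R B D v

/-- Two configurations are adjacent: they agree on all edges except one. -/
def AdjConf {V : Type*} (R B : SimpleGraph V) (D D' : Sym2 V → V) : Prop :=
  ∃ e₀ : Sym2 V, ∀ e ∈ R.edgeSet ∪ B.edgeSet, e ≠ e₀ → D e = D' e

/-- A reconfiguration between configurations of the NCL instance `(R, B)`. -/
def NCLReconf {V : Type*} (R B : SimpleGraph V) : (Sym2 V → V) → (Sym2 V → V) → Prop :=
  Relation.ReflTransGen fun D D' => ValidConf R B D ∧ ValidConf R B D' ∧ AdjConf R B D D'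

/-- An AND vertex: incident to two red edges and one blue edge. -/
def ANDv {V : Type*} (R B : SimpleGraph V) (u : V) : Prop :=
  (R.neighborSet u).ncard = 2 ∧ (B.neighborSet u).ncard = 1

/-- An OR vertex: incident to three blue edges and no red edges. -/
def ORv {V : Type*} (R B : SimpleGraph V) (u : V) : Prop :=
  (R.neighborSet u).ncard = 0 ∧ (B.neighborSet u).ncard = 3

/-- A COPY vertex: incident to two blue edges and no red edges. -/
def COPYv {V : Type*} (R B : SimpleGraph V) (u : V) : Prop :=
  (R.neighborSet u).ncard = 0 ∧ (B.neighborSet u).ncard = 2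

/-- The split graph `G_b` built from the NCL instance `(R, B)`, described by its
vertex families and adjacency.  A dart `d` of `R ⊔ B` (an edge `e = s(d.fst, d.snd)`
together with the chosen endpoint `d.fst`) represents the selector vertex
`e_{d.fst}`; `gr e` is the gate of a red edge `e`; `gb (e, i)` (`i ∈ {0,1}`) are
the two gates of a blue edge `e`; and `orAssign e i` records, for a blue edge `e`
incident to an OR vertex `v`, which other blue edge at `v` has its selector
attached to the gate `gb (e, i)`.  The adjacency fields state exactly which pairs
of vertices are adjacent, following the construction: gates form a clique,
selectors are independent, each gate is adjacent to the two selectors of its own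
edge and to the prescribed selectors coming from the AND/OR/COPY wiring. -/
structure GbSetup {V : Type*} (R B : SimpleGraph V) (VB : Type*) where
  Gb : SimpleGraph VB
  sel : (R ⊔ B).Dart → VB
  gr : ↥R.edgeSet → VB
  gb : ↥B.edgeSet × Fin 2 → VB
  orAssign : ↥B.edgeSet → Fin 2 → Sym2 V
  sel_inj : Function.Injective sel
  gr_inj : Function.Injective gr
  gb_inj : Function.Injective gb
  sel_ne_gr : ∀ d e, sel d ≠ gr e
  sel_ne_gb : ∀ d p, sel d ≠ gb p
  gr_ne_gb : ∀ e p, gr e ≠ gb p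
  cover : ∀ x : VB, (∃ d, x = sel d) ∨ (∃ e, x = gr e) ∨ (∃ p, x = gb p)
  adj_sel_sel : ∀ d d', ¬ Gb.Adj (sel d) (sel d')
  adj_gr_gr : ∀ e e', e ≠ e' → Gb.Adj (gr e) (gr e')
  adj_gr_gb : ∀ e p, Gb.Adj (gr e) (gb p)
  adj_gb_gb : ∀ p p', p ≠ p' → Gb.Adj (gb p) (gb p')
  adj_sel_gr : ∀ (d : (R ⊔ B).Dart) (e : ↥R.edgeSet),
    Gb.Adj (sel d) (gr e) ↔
      (d.edge = (e : Sym2 V) ∨ (d.edge ∈ B.edgeSet ∧ d.snd ∈ (e : Sym2 V)))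
  adj_sel_gb_and : ∀ (d : (R ⊔ B).Dart) (e : ↥B.edgeSet) (i : Fin 2) (v : V),
    v ∈ (e : Sym2 V) → ANDv R B v →
    (Gb.Adj (sel d) (gb (e, i)) ↔
      (d.edge = (e : Sym2 V) ∨ (d.snd ∈ (e : Sym2 V) ∧ d.edge ≠ (e : Sym2 V))))
  adj_sel_gb_or : ∀ (d : (R ⊔ B).Dart) (e : ↥B.edgeSet) (i : Fin 2) (v : V),
    v ∈ (e : Sym2 V) → ORv R B v →
    (Gb.Adj (sel d) (gb (e, i)) ↔
      (d.edge = (e : Sym2 V) ∨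
        (d.snd ∈ (e : Sym2 V) ∧ d.edge ≠ (e : Sym2 V) ∧
          (d.snd = v → d.edge = orAssign e i))))
  orAssign_mem : ∀ (e : ↥B.edgeSet) (i : Fin 2) (v : V), v ∈ (e : Sym2 V) → ORv R B v →
    v ∈ orAssign e i ∧ orAssign e i ∈ B.edgeSet ∧ orAssign e i ≠ (e : Sym2 V)
  orAssign_ne : ∀ (e : ↥B.edgeSet) (v : V), v ∈ (e : Sym2 V) → ORv R B v →
    orAssign e 0 ≠ orAssign e 1

/-- The independent set of `G_b` corresponding to a configuration `D` of `(R, B)`: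
for each edge `e = uv`, it contains the selector `e_u` exactly when `D` orients
`e` towards `u`. -/
def Sconf {V : Type*} {R B : SimpleGraph V} {VB : Type*} (st : GbSetup R B VB)
    (D : Sym2 V → V) : Set VB :=
  {x | ∃ d : (R ⊔ B).Dart, x = st.sel d ∧ D d.edge = d.fst}

/-- A set of vertices of `G_b` is good if it is independent and contains at most
one of the two selectors `e_u`, `e_v` of every edge `e = uv` of `G`. -/
def GoodSet {V : Type*} {R B : SimpleGraph V} {VB : Type*} (st : GbSetup R B VB)
    (X : Set VB) : Prop :=
  IsIndep st.Gb X ∧ ∀ d : (R ⊔ B).Dart, ¬ (st.sel d ∈ X ∧ st.sel d.symm ∈ X)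

/-- Reachability by TS moves through good independent sets of `G_b`. -/
def GoodReach {V : Type*} {R B : SimpleGraph V} {VB : Type*} (st : GbSetup R B VB) :
    Set VB → Set VB → Prop :=
  Relation.ReflTransGen fun X Y => GoodSet st X ∧ GoodSet st Y ∧ TSMove st.Gb X Y

/-- The weighted in-degree of `v` under `D`, not counting the edge `e`. -/
noncomputable def wInDegOff {V : Type*} (R B : SimpleGraph V) (D : Sym2 V → V) (e : Sym2 V)
    (v : V) : ℕ :=
  {f ∈ R.edgeSet | f ≠ e ∧ D f = v}.ncard + 2 * {f ∈ B.edgeSet | f ≠ e ∧ D f = v}.ncard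

/-- The selectors of `Sconf st D` belonging to edges other than `e`. -/
def SconfOff {V : Type*} {R B : SimpleGraph V} {VB : Type*} (st : GbSetup R B VB)
    (D : Sym2 V → V) (e : Sym2 V) : Set VB :=
  {x | ∃ d : (R ⊔ B).Dart, x = st.sel d ∧ d.edge ≠ e ∧ D d.edge = d.fst}

/-- `g` is a gate of the edge `e`. -/
def IsGate {V : Type*} {R B : SimpleGraph V} {VB : Type*} (st : GbSetup R B VB)
    (g : VB) (e : Sym2 V) : Prop :=
  (∃ h : e ∈ R.edgeSet, g = st.gr ⟨e, h⟩) ∨ ∃ (h : e ∈ B.edgeSet) (i : Fin 2), g = st.gb (⟨e, h⟩, i)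

/-- `D` orients every edge towards one of its endpoints. -/
def Oriented {V : Type*} (R B : SimpleGraph V) (D : Sym2 V → V) : Prop :=
  ∀ e ∈ R.edgeSet ∪ B.edgeSet, D e ∈ e

/-- The gate `g` is adjacent to no selector chosen by `D` at an edge other than `e`. -/
def GateFree {V : Type*} {R B : SimpleGraph V} {VB : Type*} (st : GbSetup R B VB)
    (D : Sym2 V → V) (e : Sym2 V) (g : VB) : Prop :=
  ∀ x ∈ SconfOff st D e, ¬ st.Gb.Adj x g

section Darts

variable {V : Type*} {G : SimpleGraph V}

theorem exists_dart_fst {e : Sym2 V} (he : e ∈ G.edgeSet) {u : V} (hu : u ∈ e) :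
    ∃ d : G.Dart, d.edge = e ∧ d.fst = u := by
  obtain ⟨w, rfl⟩ := Sym2.mem_iff_exists.mp hu
  exact ⟨⟨(u, w), he⟩, rfl, rfl⟩

theorem exists_dart_snd {e : Sym2 V} (he : e ∈ G.edgeSet) {u : V} (hu : u ∈ e) :
    ∃ d : G.Dart, d.edge = e ∧ d.snd = u := by
  obtain ⟨d, h, h'⟩ := exists_dart_fst he hu
  exact ⟨d.symm, by simpa using h, by simpa using h'⟩

theorem Dart.mem_edge_iff (d : G.Dart) (u : V) : u ∈ d.edge ↔ u = d.fst ∨ u = d.snd := by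
  rw [show d.edge = s(d.fst, d.snd) from rfl, Sym2.mem_iff]

theorem dart_eq_of_edge_fst {d d' : G.Dart} (h : d.edge = d'.edge) (h' : d.fst = d'.fst) :
    d = d' := by
  rcases (dart_edge_eq_iff d d').mp h with h1 | h1
  · exact h1
  · subst h1
    exact absurd h'.symm d'.fst_ne_snd

theorem ncard_incidenceSet (G : SimpleGraph V) (u : V) :
    (G.incidenceSet u).ncard = (G.neighborSet u).ncard := by
  classical
  exact Nat.card_congr (G.incidenceSetEquivNeighborSet u)

end Darts

section Degrees

variable {V : Type*} {R B : SimpleGraph V} {D D' : Sym2 V → V} {e : Sym2 V} {u : V}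

theorem two_le_wInDegOff_iff [Finite V] :
    2 ≤ wInDegOff R B D e u ↔ (∃ f ∈ B.edgeSet, f ≠ e ∧ D f = u) ∨
      ∃ f ∈ R.edgeSet, ∃ g ∈ R.edgeSet, f ≠ g ∧ (f ≠ e ∧ D f = u) ∧ g ≠ e ∧ D g = u := by
  have hB : (∃ f ∈ B.edgeSet, f ≠ e ∧ D f = u) ↔
      0 < {f ∈ B.edgeSet | f ≠ e ∧ D f = u}.ncard := by
    rw [Set.ncard_pos (Set.toFinite _)]; rfl
  have hR : (∃ f ∈ R.edgeSet, ∃ g ∈ R.edgeSet, f ≠ g ∧ (f ≠ e ∧ D f = u) ∧ g ≠ e ∧ D g = u) ↔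
      1 < {f ∈ R.edgeSet | f ≠ e ∧ D f = u}.ncard := by
    rw [Set.one_lt_ncard (Set.toFinite _)]
    constructor
    · rintro ⟨f, hf, g, hg, hfg, h1, h2⟩
      exact ⟨f, ⟨hf, h1⟩, g, ⟨hg, h2⟩, hfg⟩
    · rintro ⟨f, ⟨hf, h1⟩, g, ⟨hg, h2⟩, hfg⟩
      exact ⟨f, hf, g, hg, hfg, h1, h2⟩
  rw [hB, hR, wInDegOff]
  omega

theorem wInDegOff_eq (h : D e ≠ u) : wInDegOff R B D e u = wInDeg R B D u := by
  have key (s : Set (Sym2 V)) : {f ∈ s | f ≠ e ∧ D f = u} = {f ∈ s | D f = u} := by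
    ext f; simp only [Set.mem_ofPred_eq]; grind
  rw [wInDegOff, wInDeg, key, key]

theorem wInDegOff_le [Finite V] : wInDegOff R B D e u ≤ wInDeg R B D u := by
  have key (s : Set (Sym2 V)) : {f ∈ s | f ≠ e ∧ D f = u}.ncard ≤ {f ∈ s | D f = u}.ncard :=
    Set.ncard_le_ncard (fun f hf => ⟨hf.1, hf.2.2⟩) (Set.toFinite _)
  have h1 := key R.edgeSet
  have h2 := key B.edgeSet
  rw [wInDegOff, wInDeg]
  omega

theorem wInDegOff_congr (h : ∀ f ∈ R.edgeSet ∪ B.edgeSet, f ≠ e → D f = D' f) (u : V) :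
    wInDegOff R B D e u = wInDegOff R B D' e u := by
  have key (s : Set (Sym2 V)) (hs : s ⊆ R.edgeSet ∪ B.edgeSet) :
      {f ∈ s | f ≠ e ∧ D f = u} = {f ∈ s | f ≠ e ∧ D' f = u} := by
    ext f; simp only [Set.mem_ofPred_eq]; grind
  rw [wInDegOff, wInDegOff, key _ Set.subset_union_left, key _ Set.subset_union_right]

/-- Changing `D` at `e` keeps it valid if both ends of `e` are satisfied by the other edges. -/
theorem ValidConf.of_agree_off [Finite V] (hD : ValidConf R B D) (he : e ∈ R.edgeSet ∪ B.edgeSet)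
    (h : ∀ f ∈ R.edgeSet ∪ B.edgeSet, f ≠ e → D f = D' f) (hD'e : D' e ∈ e)
    (hoff : ∀ u ∈ e, 2 ≤ wInDegOff R B D e u) : ValidConf R B D' := by
  refine ⟨fun f hf => ?_, fun u => ?_⟩
  · by_cases hfe : f = e
    · exact hfe ▸ hD'e
    · exact h f hf hfe ▸ hD.1 f hf
  · refine le_trans ?_ (wInDegOff_le (e := e))
    rw [← wInDegOff_congr h u]
    by_cases hu : u ∈ e
    · exact hoff u hu
    · rw [wInDegOff_eq fun (hDe : D e = u) => hu (hDe ▸ hD.1 e he)]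
      exact hD.2 u

/-- If `e` is oriented differently by two valid configurations agreeing elsewhere, then both
ends of `e` are satisfied by the other edges. -/
theorem ValidConf.two_le_wInDegOff (hD : ValidConf R B D) (hD' : ValidConf R B D')
    (h : ∀ f ∈ R.edgeSet ∪ B.edgeSet, f ≠ e → D f = D' f) (hne : D e ≠ D' e) (u : V) :
    2 ≤ wInDegOff R B D e u := by
  by_cases hu : D e = u
  · rw [wInDegOff_congr h, wInDegOff_eq (hu ▸ hne.symm)]
    exact hD'.2 u
  · rw [wInDegOff_eq hu]
    exact hD.2 u

theorem ANDv.exists_edges (h : ANDv R B u) : ∃ p q b, p ≠ q ∧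
    (∀ f, f ∈ R.edgeSet ∧ u ∈ f ↔ f = p ∨ f = q) ∧ ∀ f, f ∈ B.edgeSet ∧ u ∈ f ↔ f = b := by
  obtain ⟨h1, h2⟩ := h
  rw [← ncard_incidenceSet] at h1 h2
  obtain ⟨p, q, hpq, hR⟩ := Set.ncard_eq_two.mp h1
  obtain ⟨b, hB⟩ := Set.ncard_eq_one.mp h2
  exact ⟨p, q, b, hpq, fun f => Set.ext_iff.mp hR f, fun f => Set.ext_iff.mp hB f⟩

theorem notMem_of_ncard_neighborSet_eq_zero [Finite V] {G : SimpleGraph V}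
    (h : (G.neighborSet u).ncard = 0) {f : Sym2 V} (hf : f ∈ G.edgeSet) : u ∉ f := by
  rw [← ncard_incidenceSet, Set.ncard_eq_zero (Set.toFinite _)] at h
  exact fun hu => Set.eq_empty_iff_forall_notMem.mp h f ⟨hf, hu⟩

theorem ORv.exists_edges (h : ORv R B u) : ∃ p q r,
    ∀ f, f ∈ B.edgeSet ∧ u ∈ f ↔ f = p ∨ f = q ∨ f = r := by
  have h2 := h.2
  rw [← ncard_incidenceSet] at h2
  obtain ⟨p, q, r, -, -, -, hB⟩ := Set.ncard_eq_three.mp h2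
  exact ⟨p, q, r, fun f => Set.ext_iff.mp hB f⟩

theorem COPYv.exists_edges (h : COPYv R B u) : ∃ p q, p ≠ q ∧
    ∀ f, f ∈ B.edgeSet ∧ u ∈ f ↔ f = p ∨ f = q := by
  have h2 := h.2
  rw [← ncard_incidenceSet] at h2
  obtain ⟨p, q, hpq, hB⟩ := Set.ncard_eq_two.mp h2
  exact ⟨p, q, hpq, fun f => Set.ext_iff.mp hB f⟩

theorem ANDv.two_le_wInDegOff_red [Finite V] (h : ANDv R B u) (hdisj : Disjoint R.edgeSet B.edgeSet)
    (hD : Oriented R B D) (he : e ∈ R.edgeSet) (hu : u ∈ e) :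
    2 ≤ wInDegOff R B D e u ↔ ∀ f ∈ B.edgeSet, u ∈ f → D f = u := by
  obtain ⟨p, q, b, hpq, hR, hB⟩ := h.exists_edges
  have hd := fun f (hf : f ∈ R.edgeSet) => Set.disjoint_left.mp hdisj hf
  have hDR := fun f hf => hD f (Or.inl hf)
  have hDB := fun f hf => hD f (Or.inr hf)
  rw [two_le_wInDegOff_iff]
  constructor
  · rintro (⟨f, hf, hfe, rfl⟩ | ⟨f, hf, g, hg, hfg, ⟨hfe, rfl⟩, hge, hgu⟩) <;> grind
  · intro hf
    exact Or.inl ⟨b, by grind⟩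

theorem ANDv.two_le_wInDegOff_blue [Finite V] (h : ANDv R B u) (hdisj : Disjoint R.edgeSet B.edgeSet)
    (hD : Oriented R B D) (he : e ∈ B.edgeSet) (hu : u ∈ e) :
    2 ≤ wInDegOff R B D e u ↔
      ∀ f ∈ R.edgeSet ∪ B.edgeSet, f ≠ e → u ∈ f → D f = u := by
  obtain ⟨p, q, b, hpq, hR, hB⟩ := h.exists_edges
  have hd := fun f (hf : f ∈ R.edgeSet) => Set.disjoint_left.mp hdisj hf
  have hDR := fun f hf => hD f (Or.inl hf)
  have hDB := fun f hf => hD f (Or.inr hf)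
  simp only [two_le_wInDegOff_iff, Set.mem_union]
  constructor
  · rintro (⟨f, hf, hfe, rfl⟩ | ⟨f, hf, g, hg, hfg, ⟨hfe, rfl⟩, hge, hgu⟩) <;> grind
  · intro hf
    exact Or.inr ⟨p, by grind, q, by grind⟩

theorem COPYv.two_le_wInDegOff [Finite V] (h : COPYv R B u) (hD : Oriented R B D)
    (he : e ∈ B.edgeSet) (hu : u ∈ e) :
    2 ≤ wInDegOff R B D e u ↔
      ∀ f ∈ R.edgeSet ∪ B.edgeSet, f ≠ e → u ∈ f → D f = u := by
  obtain ⟨p, q, hpq, hB⟩ := h.exists_edges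
  have hR : ∀ f ∈ R.edgeSet, u ∉ f := fun f => notMem_of_ncard_neighborSet_eq_zero h.1
  have hDR := fun f hf => hD f (Or.inl hf)
  have hDB := fun f hf => hD f (Or.inr hf)
  simp only [two_le_wInDegOff_iff, Set.mem_union]
  constructor
  · rintro (⟨f, hf, hfe, rfl⟩ | ⟨f, hf, g, hg, hfg, ⟨hfe, rfl⟩, hge, hgu⟩) <;> grind
  · intro hf
    by_cases hp : p = e
    · exact Or.inl ⟨q, by grind⟩
    · exact Or.inl ⟨p, by grind⟩

theorem ORv.two_le_wInDegOff [Finite V] (h : ORv R B u) (hD : Oriented R B D)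
    (he : e ∈ B.edgeSet) (hu : u ∈ e) {a b : Sym2 V} (ha : a ∈ B.edgeSet) (hua : u ∈ a)
    (hae : a ≠ e) (hb : b ∈ B.edgeSet) (hub : u ∈ b) (hbe : b ≠ e) (hab : a ≠ b) :
    2 ≤ wInDegOff R B D e u ↔ D a = u ∨ D b = u := by
  obtain ⟨p, q, r, hB⟩ := h.exists_edges
  have hR : ∀ f ∈ R.edgeSet, u ∉ f := fun f => notMem_of_ncard_neighborSet_eq_zero h.1
  have hDR := fun f hf => hD f (Or.inl hf)
  have hDB := fun f hf => hD f (Or.inr hf)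
  rw [two_le_wInDegOff_iff]
  constructor
  · rintro (⟨f, hf, hfe, rfl⟩ | ⟨f, hf, g, hg, hfg, ⟨hfe, rfl⟩, hge, hgu⟩) <;> grind
  · rintro (h | h)
    · exact Or.inl ⟨a, ha, hae, h⟩
    · exact Or.inl ⟨b, hb, hbe, h⟩

end Degrees

section Gates

variable {V : Type*} {R B : SimpleGraph V} {VB : Type*} {st : GbSetup R B VB}
  {D D' : Sym2 V → V} {e : Sym2 V}

theorem Dart.edge_mem_union (d : (R ⊔ B).Dart) : d.edge ∈ R.edgeSet ∪ B.edgeSet := by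
  rw [← edgeSet_sup]
  exact d.edge_mem

theorem IsGate.mem_edgeSet {g : VB} (h : IsGate st g e) : e ∈ (R ⊔ B).edgeSet := by
  rw [edgeSet_sup]
  rcases h with ⟨h, -⟩ | ⟨h, -⟩
  exacts [Or.inl h, Or.inr h]

theorem IsGate.ne_sel {g : VB} (h : IsGate st g e) (d : (R ⊔ B).Dart) : st.sel d ≠ g := by
  rcases h with ⟨h, rfl⟩ | ⟨h, i, rfl⟩
  exacts [st.sel_ne_gr _ _, st.sel_ne_gb _ _]

theorem IsGate.adj {g g' : VB} {e' : Sym2 V} (h : IsGate st g e) (h' : IsGate st g' e')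
    (hne : g ≠ g') : st.Gb.Adj g g' := by
  rcases h with ⟨h, rfl⟩ | ⟨h, i, rfl⟩ <;> rcases h' with ⟨h', rfl⟩ | ⟨h', i', rfl⟩
  · exact st.adj_gr_gr _ _ fun heq => hne (heq ▸ rfl)
  · exact st.adj_gr_gb _ _
  · exact (st.adj_gr_gb _ _).symm
  · exact st.adj_gb_gb _ _ fun heq => hne (heq ▸ rfl)

theorem exists_sel_or_isGate (st : GbSetup R B VB) (x : VB) :
    (∃ d, x = st.sel d) ∨ ∃ e, IsGate st x e := by
  rcases st.cover x with h | ⟨e, rfl⟩ | ⟨⟨e, i⟩, rfl⟩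
  · exact Or.inl h
  · exact Or.inr ⟨e, Or.inl ⟨e.2, rfl⟩⟩
  · exact Or.inr ⟨e, Or.inr ⟨e.2, i, rfl⟩⟩

theorem Oriented.edge_eq_fst_or_snd (hD : Oriented R B D) (d : (R ⊔ B).Dart) :
    D d.edge = d.fst ∨ D d.edge = d.snd :=
  (Dart.mem_edge_iff d _).mp (hD _ (Dart.edge_mem_union d))

theorem gateFree_iff {g : VB} : GateFree st D e g ↔
    ∀ d, d.edge ≠ e → D d.edge = d.fst → ¬ st.Gb.Adj (st.sel d) g := by
  constructor
  · exact fun h d h1 h2 => h _ ⟨d, rfl, h1, h2⟩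
  · rintro h _ ⟨d, rfl, h1, h2⟩
    exact h d h1 h2

/-- An adjacency rule for a gate in terms of the tail of a selector translates freeness into
a condition on the edges at the ends of `e`. -/
theorem gateFree_iff_forall (hD : Oriented R B D) {g : VB} (P : V → Sym2 V → Prop)
    (hP : ∀ d : (R ⊔ B).Dart, d.edge ≠ e → (st.Gb.Adj (st.sel d) g ↔ P d.snd d.edge)) :
    GateFree st D e g ↔
      ∀ u, ∀ f ∈ R.edgeSet ∪ B.edgeSet, f ≠ e → u ∈ f → P u f → D f = u := by
  rw [gateFree_iff]
  constructor
  · intro h u f hf hfe hu hPf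
    obtain ⟨d, rfl, rfl⟩ := exists_dart_snd (G := R ⊔ B) (by rwa [edgeSet_sup]) hu
    refine (hD.edge_eq_fst_or_snd d).resolve_left fun hd => ?_
    exact h d hfe hd ((hP d hfe).mpr hPf)
  · intro h d hde hd hadj
    have := h d.snd d.edge (Dart.edge_mem_union d) hde
      ((Dart.mem_edge_iff d _).mpr (Or.inr rfl)) ((hP d hde).mp hadj)
    exact d.fst_ne_snd (hd.symm.trans this)

end Gates

section Main

variable {V : Type*} {R B : SimpleGraph V} {VB : Type*} {st : GbSetup R B VB}
  {D D' : Sym2 V → V} {e : Sym2 V}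

theorem IsGate.adj_sel (htypes : ∀ u : V, ANDv R B u ∨ ORv R B u ∨ COPYv R B u)
    (hblue : ∀ u v : V, B.Adj u v → (COPYv R B u ↔ ¬ COPYv R B v))
    {g : VB} (h : IsGate st g e) {d : (R ⊔ B).Dart}
    (hd : d.edge = e) : st.Gb.Adj (st.sel d) g := by
  rcases h with ⟨h, rfl⟩ | ⟨h, i, rfl⟩
  · exact (st.adj_sel_gr _ _).mpr (Or.inl hd)
  · induction e with | _ u v
    have huv := hblue u v h
    have : ∃ w ∈ s(u, v), ANDv R B w ∨ ORv R B w := by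
      have := htypes u
      have := htypes v
      by_cases hu : COPYv R B u
      · exact ⟨v, by simp, by tauto⟩
      · exact ⟨u, by simp, by tauto⟩
    obtain ⟨w, hw, hA | hO⟩ := this
    · exact (st.adj_sel_gb_and _ _ _ w hw hA).mpr (Or.inl hd)
    · exact (st.adj_sel_gb_or _ _ _ w hw hO).mpr (Or.inl hd)

theorem exists_gateFree_iff_red [Finite V] (hdisj : Disjoint R.edgeSet B.edgeSet)
    (htypes : ∀ u : V, ANDv R B u ∨ ORv R B u ∨ COPYv R B u)
    (hD : Oriented R B D) (he : e ∈ R.edgeSet) :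
    (∃ g, IsGate st g e ∧ GateFree st D e g) ↔ ∀ u ∈ e, 2 ≤ wInDegOff R B D e u := by
  have hd := fun f (hf : f ∈ R.edgeSet) => Set.disjoint_left.mp hdisj hf
  have hAND : ∀ u ∈ e, ANDv R B u := fun u hu => by
    rcases htypes u with h | h | h
    · exact h
    · exact absurd hu (notMem_of_ncard_neighborSet_eq_zero h.1 he)
    · exact absurd hu (notMem_of_ncard_neighborSet_eq_zero h.1 he)
  have hgate : (∃ g, IsGate st g e ∧ GateFree st D e g) ↔ GateFree st D e (st.gr ⟨e, he⟩) := by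
    constructor
    · rintro ⟨g, ⟨_, rfl⟩ | ⟨h, -⟩, hg⟩
      · exact hg
      · exact absurd h (hd e he)
    · exact fun h => ⟨_, Or.inl ⟨he, rfl⟩, h⟩
  rw [hgate, gateFree_iff_forall hD (fun u f => f ∈ B.edgeSet ∧ u ∈ e) fun d hde => by
    rw [st.adj_sel_gr]; simp [hde]]
  have key : (∀ u ∈ e, 2 ≤ wInDegOff R B D e u) ↔
      ∀ u ∈ e, ∀ f ∈ B.edgeSet, u ∈ f → D f = u :=
    forall₂_congr fun u hu => (hAND u hu).two_le_wInDegOff_red hdisj hD he hu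
  rw [key]
  constructor
  · intro h u hu f hf huf
    exact h u f (Or.inr hf) (fun hfe => hd f (hfe ▸ he) hf) huf ⟨hf, hu⟩
  · rintro h u f - - huf ⟨hf, hu⟩
    exact h u hu f hf huf

theorem exists_gateFree_iff_blue [Finite V] (hdisj : Disjoint R.edgeSet B.edgeSet)
    (htypes : ∀ u : V, ANDv R B u ∨ ORv R B u ∨ COPYv R B u)
    (hD : Oriented R B D) (he : e ∈ B.edgeSet) {v w : V} (hvw : ∀ u, u ∈ e ↔ u = v ∨ u = w)
    (hv : ¬ COPYv R B v) (hw : COPYv R B w) :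
    (∃ g, IsGate st g e ∧ GateFree st D e g) ↔ ∀ u ∈ e, 2 ≤ wInDegOff R B D e u := by
  have hd := fun f (hf : f ∈ R.edgeSet) => Set.disjoint_left.mp hdisj hf
  have hve : v ∈ e := (hvw v).mpr (Or.inl rfl)
  have hwe : w ∈ e := (hvw w).mpr (Or.inr rfl)
  have hne : w ≠ v := fun h => hv (h ▸ hw)
  have hgate : (∃ g, IsGate st g e ∧ GateFree st D e g) ↔
      ∃ i, GateFree st D e (st.gb (⟨e, he⟩, i)) := by
    constructor
    · rintro ⟨g, ⟨h, -⟩ | ⟨_, i, rfl⟩, hg⟩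
      · exact absurd he (hd e h)
      · exact ⟨i, hg⟩
    · exact fun ⟨i, h⟩ => ⟨_, Or.inr ⟨he, i, rfl⟩, h⟩
  have hends : (∀ u ∈ e, 2 ≤ wInDegOff R B D e u) ↔
      2 ≤ wInDegOff R B D e v ∧ 2 ≤ wInDegOff R B D e w := by
    simp [hvw]
  rw [hgate, hends, hw.two_le_wInDegOff hD he hwe]
  rcases htypes v with hA | hO | hC
  · rw [hA.two_le_wInDegOff_blue hdisj hD he hve]
    have hfree (i : Fin 2) := gateFree_iff_forall (st := st) (e := e) (g := st.gb (⟨e, he⟩, i))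
      hD (fun u _ => u ∈ e) fun d hde => by
        rw [st.adj_sel_gb_and _ _ _ v hve hA]; simp [hde]
    simp only [hfree, exists_const, hvw]
    constructor
    · exact fun h => ⟨fun f hf hfe hu => h _ f hf hfe hu (Or.inl rfl),
        fun f hf hfe hu => h _ f hf hfe hu (Or.inr rfl)⟩
    · rintro ⟨h1, h2⟩ u f hf hfe hu (rfl | rfl)
      exacts [h1 f hf hfe hu, h2 f hf hfe hu]
  · obtain ⟨h0v, h0B, h0e⟩ := st.orAssign_mem ⟨e, he⟩ 0 v hve hO
    obtain ⟨h1v, h1B, h1e⟩ := st.orAssign_mem ⟨e, he⟩ 1 v hve hO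
    rw [hO.two_le_wInDegOff hD he hve h0B h0v h0e h1B h1v h1e (st.orAssign_ne ⟨e, he⟩ v hve hO)]
    have hfree (i : Fin 2) : GateFree st D e (st.gb (⟨e, he⟩, i)) ↔
        D (st.orAssign ⟨e, he⟩ i) = v ∧
          ∀ f ∈ R.edgeSet ∪ B.edgeSet, f ≠ e → w ∈ f → D f = w := by
      obtain ⟨hiv, hiB, hie⟩ := st.orAssign_mem ⟨e, he⟩ i v hve hO
      rw [gateFree_iff_forall hD
        (fun u f => u ∈ e ∧ (u = v → f = st.orAssign ⟨e, he⟩ i)) fun d hde => by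
          rw [st.adj_sel_gb_or _ _ _ v hve hO]; simp [hde]]
      constructor
      · intro h
        exact ⟨h v _ (Or.inr hiB) hie hiv ⟨hve, fun _ => rfl⟩,
          fun f hf hfe hu => h w f hf hfe hu ⟨hwe, fun h => absurd h hne⟩⟩
      · rintro ⟨h1, h2⟩ u f hf hfe huf ⟨hue, hu⟩
        rcases (hvw u).mp hue with rfl | rfl
        · rw [hu rfl, h1]
        · exact h2 f hf hfe huf
    simp only [hfree, Fin.exists_fin_two]
    tauto
  · exact absurd hC hv

/-- Some gate of `e` is free if and only if the remaining edges satisfy both ends of `e`. -/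
theorem exists_gateFree_iff [Finite V] (hdisj : Disjoint R.edgeSet B.edgeSet)
    (htypes : ∀ u : V, ANDv R B u ∨ ORv R B u ∨ COPYv R B u)
    (hblue : ∀ u v : V, B.Adj u v → (COPYv R B u ↔ ¬ COPYv R B v))
    (hD : Oriented R B D) (he : e ∈ R.edgeSet ∪ B.edgeSet) :
    (∃ g, IsGate st g e ∧ GateFree st D e g) ↔ ∀ u ∈ e, 2 ≤ wInDegOff R B D e u := by
  rcases he with he | he
  · exact exists_gateFree_iff_red hdisj htypes hD he
  · induction e with | _ u v
    have huv := hblue u v he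
    by_cases hu : COPYv R B u
    · exact exists_gateFree_iff_blue hdisj htypes hD he (v := v) (w := u)
        (fun x => by rw [Sym2.mem_iff, or_comm]) (huv.mp hu) hu
    · exact exists_gateFree_iff_blue hdisj htypes hD he (v := u) (w := v)
        (fun x => Sym2.mem_iff) hu (by tauto)

theorem sconf_congr (h : ∀ f ∈ R.edgeSet ∪ B.edgeSet, D f = D' f) :
    Sconf st D = Sconf st D' := by
  ext x
  exact exists_congr fun d => by rw [h _ (Dart.edge_mem_union d)]

theorem sconfOff_congr (h : ∀ f ∈ R.edgeSet ∪ B.edgeSet, f ≠ e → D f = D' f) :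
    SconfOff st D e = SconfOff st D' e := by
  ext x
  exact exists_congr fun d => and_congr_right fun _ => and_congr_right fun hde => by
    rw [h _ (Dart.edge_mem_union d) hde]

theorem eq_of_sconf_eq (hD : Oriented R B D) (h : Sconf st D = Sconf st D') :
    ∀ f ∈ R.edgeSet ∪ B.edgeSet, D f = D' f := by
  intro f hf
  obtain ⟨d, rfl, hd⟩ := exists_dart_fst (G := R ⊔ B) (by rwa [edgeSet_sup]) (hD f hf)
  have hmem : st.sel d ∈ Sconf st D' := h ▸ ⟨d, rfl, hd.symm⟩
  obtain ⟨d', hdd', hd'⟩ := hmem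
  rw [← st.sel_inj hdd'] at hd'
  rw [hd', hd]

theorem sconf_eq_insert {d : (R ⊔ B).Dart} (hd : D d.edge = d.fst) :
    Sconf st D = insert (st.sel d) (SconfOff st D d.edge) := by
  ext x
  constructor
  · rintro ⟨d', rfl, hd'⟩
    by_cases h : d'.edge = d.edge
    · exact Or.inl (congrArg _ (dart_eq_of_edge_fst h (by rw [← hd', ← hd, h])))
    · exact Or.inr ⟨d', rfl, h, hd'⟩
  · rintro (rfl | ⟨d', rfl, -, hd'⟩)
    exacts [⟨d, rfl, hd⟩, ⟨d', rfl, hd'⟩]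

theorem sel_notMem_sconfOff (d : (R ⊔ B).Dart) : st.sel d ∉ SconfOff st D d.edge := by
  rintro ⟨d', h, hne, -⟩
  exact hne (st.sel_inj h ▸ rfl)

theorem IsGate.notMem_sconfOff {g : VB} (hg : IsGate st g e) {e' : Sym2 V} :
    g ∉ SconfOff st D e' := by
  rintro ⟨d, h, -⟩
  exact hg.ne_sel d h.symm

theorem IsGate.notMem_sconf {g : VB} (hg : IsGate st g e) : g ∉ Sconf st D := by
  rintro ⟨d, h, -⟩
  exact hg.ne_sel d h.symm

theorem tsMove_insert {α : Type*} {G : SimpleGraph α} {Z : Set α} {a b : α}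
    (ha : a ∉ Z) (hb : b ∉ Z) (hab : G.Adj a b) : TSMove G (insert b Z) (insert a Z) := by
  have hne := hab.ne
  refine ⟨?_, a, b, hab, ?_, ?_⟩
  · have := Set.ncard_exchange (s := insert b Z) (a := a) (b := b)
      (by simp [hne, ha]) (Set.mem_insert b Z)
    rw [← this]
    congr 2
    ext x; simp only [Set.mem_sdiff, Set.mem_insert_iff, Set.mem_singleton_iff]; grind
  · ext x; simp only [Set.mem_sdiff, Set.mem_insert_iff, Set.mem_singleton_iff]; grind
  · ext x; simp only [Set.mem_sdiff, Set.mem_insert_iff, Set.mem_singleton_iff]; grind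

theorem TSMove.eq_insert {α : Type*} {G : SimpleGraph α} {S T : Set α} (h : TSMove G S T) :
    ∃ a b, G.Adj a b ∧ a ∉ S ∧ b ∈ S ∧ T = insert a (S \ {b}) := by
  obtain ⟨-, a, b, hab, hTS, hST⟩ := h
  have ha : a ∈ T \ S := hTS ▸ rfl
  have hb : b ∈ S \ T := hST ▸ rfl
  refine ⟨a, b, hab, ha.2, hb.1, ?_⟩
  ext x
  have h1 := Set.ext_iff.mp hTS x
  have h2 := Set.ext_iff.mp hST x
  simp only [Set.mem_sdiff, Set.mem_insert_iff, Set.mem_singleton_iff] at *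
  tauto

theorem goodSet_sconf (st : GbSetup R B VB) (D : Sym2 V → V) : GoodSet st (Sconf st D) := by
  refine ⟨?_, ?_⟩
  · rintro _ ⟨d, rfl, -⟩ _ ⟨d', rfl, -⟩ -
    exact st.adj_sel_sel d d'
  · rintro d ⟨⟨d1, h1, hd1⟩, ⟨d2, h2, hd2⟩⟩
    rw [← st.sel_inj h1] at hd1
    rw [← st.sel_inj h2, Dart.edge_symm, hd1] at hd2
    exact d.fst_ne_snd hd2

theorem GateFree.goodSet_insert {g : VB} (hg : IsGate st g e) (hfree : GateFree st D e g) :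
    GoodSet st (insert g (SconfOff st D e)) := by
  have hsub : SconfOff st D e ⊆ Sconf st D := fun x ⟨d, h, _, h'⟩ => ⟨d, h, h'⟩
  refine ⟨?_, fun d ⟨h1, h2⟩ => ?_⟩
  · refine Set.pairwise_insert.mpr ⟨(goodSet_sconf st D).1.mono hsub, fun x hx _ => ?_⟩
    exact ⟨fun h => hfree x hx h.symm, hfree x hx⟩
  · exact (goodSet_sconf st D).2 d ⟨hsub (h1.resolve_left (hg.ne_sel _)),
      hsub (h2.resolve_left (hg.ne_sel _))⟩

theorem goodReach_of_adjConf [Finite V] (hdisj : Disjoint R.edgeSet B.edgeSet)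
    (htypes : ∀ u : V, ANDv R B u ∨ ORv R B u ∨ COPYv R B u)
    (hblue : ∀ u v : V, B.Adj u v → (COPYv R B u ↔ ¬ COPYv R B v))
    (hD : ValidConf R B D) (hD' : ValidConf R B D') (hadj : AdjConf R B D D') :
    GoodReach st (Sconf st D) (Sconf st D') := by
  obtain ⟨e, h⟩ := hadj
  by_cases heq : e ∈ R.edgeSet ∪ B.edgeSet ∧ D e ≠ D' e
  · obtain ⟨he, hne⟩ := heq
    obtain ⟨g, hg, hfree⟩ := (exists_gateFree_iff (st := st) hdisj htypes hblue hD.1 he).mpr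
      fun u _ => hD.two_le_wInDegOff hD' h hne u
    have he' : e ∈ (R ⊔ B).edgeSet := by rwa [edgeSet_sup]
    obtain ⟨d, hde, hd⟩ := exists_dart_fst he' (hD.1 e he)
    obtain ⟨d', hde', hd'⟩ := exists_dart_fst he' (hD'.1 e he)
    have hS : Sconf st D = insert (st.sel d) (SconfOff st D e) := by
      rw [sconf_eq_insert (d := d) (by rw [hde, hd]), hde]
    have hT : Sconf st D' = insert (st.sel d') (SconfOff st D e) := by
      rw [sconf_eq_insert (d := d') (by rw [hde', hd']), hde', sconfOff_congr h]
    have hgood := hfree.goodSet_insert hg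
    refine .tail (.single ⟨goodSet_sconf st D, hgood, ?_⟩) ⟨hgood, goodSet_sconf st D', ?_⟩
    · rw [hS]
      exact tsMove_insert hg.notMem_sconfOff (hde ▸ sel_notMem_sconfOff d)
        (hg.adj_sel htypes hblue hde).symm
    · rw [hT]
      exact tsMove_insert (hde' ▸ sel_notMem_sconfOff d') hg.notMem_sconfOff
        (hg.adj_sel htypes hblue hde')
  · rw [sconf_congr (D := D) (D' := D') fun f hf => ?_]
    · exact Relation.ReflTransGen.refl
    · by_cases hfe : f = e
      · by_contra hne
        exact heq (hfe ▸ ⟨hf, hne⟩)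
      · exact h f hf hfe

/-- A gate cannot enter a good set while its edge still has a selector there. -/
theorem IsGate.edge_eq_of_goodSet (htypes : ∀ u : V, ANDv R B u ∨ ORv R B u ∨ COPYv R B u)
    (hblue : ∀ u v : V, B.Adj u v → (COPYv R B u ↔ ¬ COPYv R B v))
    (hD : Oriented R B D) {g : VB} {e' : Sym2 V} (hg : IsGate st g e')
    (hY : GoodSet st (insert g (SconfOff st D e))) : e' = e := by
  by_contra hne
  obtain ⟨d, rfl, hd⟩ := exists_dart_fst hg.mem_edgeSet
    (hD e' (by rw [← edgeSet_sup]; exact hg.mem_edgeSet))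
  exact hY.1 (Or.inr ⟨d, rfl, hne, hd.symm⟩) (Or.inl rfl) (hg.ne_sel d)
    (hg.adj_sel htypes hblue rfl)

/-- `X` arises from `D`: either it is the set of selectors of `D`, or the selector of a single
edge has been replaced by a gate of that edge. -/
def Represents (st : GbSetup R B VB) (D : Sym2 V → V) (X : Set VB) : Prop :=
  X = Sconf st D ∨ ∃ e g, IsGate st g e ∧ X = insert g (SconfOff st D e)

theorem Represents.exists_of_tsMove [Finite V] (hdisj : Disjoint R.edgeSet B.edgeSet)
    (htypes : ∀ u : V, ANDv R B u ∨ ORv R B u ∨ COPYv R B u)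
    (hblue : ∀ u v : V, B.Adj u v → (COPYv R B u ↔ ¬ COPYv R B v))
    (hD : ValidConf R B D) {X Y : Set VB} (hX : GoodSet st X) (hY : GoodSet st Y)
    (hXY : TSMove st.Gb X Y) (hrep : Represents st D X) :
    ∃ D', ValidConf R B D' ∧ AdjConf R B D D' ∧ Represents st D' Y := by
  classical
  obtain ⟨a, b, hab, haX, hbX, rfl⟩ := hXY.eq_insert
  rcases hrep with rfl | ⟨e, g, hg, rfl⟩
  · obtain ⟨d, rfl, hd⟩ := hbX
    rcases exists_sel_or_isGate st a with ⟨d', rfl⟩ | ⟨e', ha⟩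
    · exact absurd hab (st.adj_sel_sel _ _)
    · have hY' : insert a (Sconf st D \ {st.sel d}) = insert a (SconfOff st D d.edge) := by
        rw [sconf_eq_insert hd, Set.insert_sdiff_self_of_notMem (sel_notMem_sconfOff d)]
      rw [hY'] at hY ⊢
      exact ⟨D, hD, ⟨e', fun _ _ _ => rfl⟩, Or.inr ⟨_, a,
        ha.edge_eq_of_goodSet htypes hblue hD.1 hY ▸ ha, rfl⟩⟩
  · have hbg : b = g := by
      by_contra hbg
      obtain ⟨d, rfl, -⟩ := hbX.resolve_left hbg
      rcases exists_sel_or_isGate st a with ⟨d', rfl⟩ | ⟨e', ha⟩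
      · exact st.adj_sel_sel _ _ hab
      · have hag : a ≠ g := fun h => haX (Or.inl h)
        exact hY.1 (Or.inl rfl) (Or.inr ⟨Or.inl rfl, Ne.symm hbg⟩) hag (ha.adj hg hag)
    subst hbg
    rw [Set.insert_sdiff_self_of_notMem hg.notMem_sconfOff] at hY ⊢
    rcases exists_sel_or_isGate st a with ⟨d, rfl⟩ | ⟨e', ha⟩
    · have he : e ∈ R.edgeSet ∪ B.edgeSet := by rw [← edgeSet_sup]; exact hg.mem_edgeSet
      have hde : d.edge = e := by
        by_contra hde
        rcases Oriented.edge_eq_fst_or_snd hD.1 d with hd | hd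
        · exact haX (Or.inr ⟨d, rfl, hde, hd⟩)
        · exact hY.2 d ⟨Or.inl rfl,
            Or.inr ⟨d.symm, rfl, by rwa [Dart.edge_symm], by rwa [Dart.edge_symm]⟩⟩
      have hfree : GateFree st D e b := fun x hx =>
        hX.1 (Or.inr hx) (Or.inl rfl) fun h => hg.notMem_sconfOff (h ▸ hx)
      have hagree : ∀ f ∈ R.edgeSet ∪ B.edgeSet, f ≠ e → D f = Function.update D e d.fst f :=
        fun f _ hfe => (Function.update_of_ne hfe _ _).symm
      have hupd : Function.update D e d.fst d.edge = d.fst := by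
        rw [hde, Function.update_self]
      refine ⟨Function.update D e d.fst, hD.of_agree_off he hagree ?_ ?_, ⟨e, hagree⟩, Or.inl ?_⟩
      · rw [Function.update_self, ← hde]
        exact (Dart.mem_edge_iff d _).mpr (Or.inl rfl)
      · exact (exists_gateFree_iff hdisj htypes hblue hD.1 he).mp ⟨b, hg, hfree⟩
      · rw [sconf_eq_insert hupd, hde, sconfOff_congr hagree]
    · exact ⟨D, hD, ⟨e', fun _ _ _ => rfl⟩, Or.inr ⟨_, a,
        ha.edge_eq_of_goodSet htypes hblue hD.1 hY ▸ ha, rfl⟩⟩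

end Main

/-- Theorem: there is a reconfiguration of valid configurations from `D` to `D'`
in the NCL instance `(R, B)` iff there is a sequence of TS moves transforming the
corresponding independent set `S` of `G_b` into the one for `D'`, such that no
independent set of the sequence contains both selectors `e_u`, `e_v` of any edge. -/
theorem stmt9 {V : Type*} [Fintype V] (R B : SimpleGraph V) {VB : Type*}
    (hdisj : Disjoint R.edgeSet B.edgeSet)
    (htypes : ∀ u : V, ANDv R B u ∨ ORv R B u ∨ COPYv R B u)
    (hblue : ∀ u v : V, B.Adj u v → (COPYv R B u ↔ ¬ COPYv R B v))
    (st : GbSetup R B VB)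
    (D D' : Sym2 V → V) (hD : ValidConf R B D) (hD' : ValidConf R B D') :
    NCLReconf R B D D' ↔ GoodReach st (Sconf st D) (Sconf st D') := by
  constructor
  · intro h
    induction h with
    | refl => exact Relation.ReflTransGen.refl
    | tail _ hstep ih =>
      obtain ⟨h1, h2, hadj⟩ := hstep
      exact (ih h1).trans (goodReach_of_adjConf hdisj htypes hblue h1 h2 hadj)
  · intro h
    have hrep (X : Set VB) (h : GoodReach st (Sconf st D) X) :
        ∃ D₁, ValidConf R B D₁ ∧ NCLReconf R B D D₁ ∧ Represents st D₁ X := by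
      induction h with
      | refl => exact ⟨D, hD, Relation.ReflTransGen.refl, Or.inl rfl⟩
      | tail _ hstep ih =>
        obtain ⟨hX, hY, hXY⟩ := hstep
        obtain ⟨D₁, hD₁, hreach, hrep⟩ := ih
        obtain ⟨D₂, hD₂, hadj, hrep'⟩ :=
          hrep.exists_of_tsMove hdisj htypes hblue hD₁ hX hY hXY
        exact ⟨D₂, hD₂, hreach.tail ⟨hD₁, hD₂, hadj⟩, hrep'⟩
    obtain ⟨D₁, hD₁, hreach, heq | ⟨e, g, hg, heq⟩⟩ := hrep _ h
    · rcases isEmpty_or_nonempty V with hV | ⟨⟨v⟩⟩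
      · exact Subsingleton.elim D₁ D' ▸ hreach
      · exact hreach.tail ⟨hD₁, hD', s(v, v), fun f hf _ => (eq_of_sconf_eq hD'.1 heq f hf).symm⟩
    · exact absurd (heq ▸ Set.mem_insert g _) hg.notMem_sconf
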